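/- Let S be a symmetric block tridiagonal matrix all of whose diagonal blocks are invertible. If v ≠ 0 is a vector supported on blocks of odd index (v = v_e) with Ψl⁻¹ * Pl *ᵥ v = 0, then Φsym⁻¹ * S *ᵥ v = v; that is, (1, v) is an eigenpair of the symmetric stair preconditioned matrix Φsym⁻¹ * S. -/

import Mathlib

open Matrix

namespace StairPrecond

/-- Real matrices indexed as n×n arrays of m×m blocks. -/
abbrev Mat (n m : ℕ) := Matrix (Fin n × Fin m) (Fin n × Fin m) ℝ

/-- Vectors compatible with `Mat n m`. -/
abbrev Vec (n m : ℕ) := Fin n × Fin m → ℝ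

/-- The (i,j)-block of a block matrix. -/
def blockOf {n m : ℕ} (M : Mat n m) (i j : Fin n) : Matrix (Fin m) (Fin m) ℝ :=
  fun a b => M (i, a) (j, b)

/-- A matrix is block tridiagonal if its (i,j)-block vanishes whenever |i - j| > 1. -/
def IsBlockTridiag {n m : ℕ} (M : Mat n m) : Prop :=
  ∀ i j : Fin n, (i.val + 1 < j.val ∨ j.val + 1 < i.val) → blockOf M i j = 0

/-- The block-diagonal part `D` of a matrix: keep only the diagonal blocks. -/
def blockDiagPart {n m : ℕ} (M : Mat n m) : Mat n m :=
  fun p q => if p.1 = q.1 then M p q else 0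

/-- The left stair Ψl: diagonal blocks everywhere, off-diagonal blocks only in
block rows of odd index (0-indexed). -/
def stairL {n m : ℕ} (M : Mat n m) : Mat n m :=
  fun p q =>
    if p.1 = q.1 ∨ (Odd p.1.val ∧ (p.1.val = q.1.val + 1 ∨ q.1.val = p.1.val + 1)) then M p q
    else 0

/-- The right stair Ψr: diagonal blocks everywhere, off-diagonal blocks only in
block rows of even index (0-indexed). -/
def stairR {n m : ℕ} (M : Mat n m) : Mat n m :=
  fun p q =>
    if p.1 = q.1 ∨ (Even p.1.val ∧ (p.1.val = q.1.val + 1 ∨ q.1.val = p.1.val + 1)) then M p q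
    else 0

/-- Pl = Ψl − S. -/
def Pl {n m : ℕ} (S : Mat n m) : Mat n m := stairL S - S

/-- Pr = Ψr − S. -/
def Pr {n m : ℕ} (S : Mat n m) : Mat n m := stairR S - S

/-- The additive stair preconditioner Φadd⁻¹ = (1/2) • (Ψl⁻¹ + Ψr⁻¹). -/
noncomputable def Phiadd {n m : ℕ} (S : Mat n m) : Mat n m :=
  (1 / 2 : ℝ) • ((stairL S)⁻¹ + (stairR S)⁻¹)

/-- The symmetric stair preconditioner Φsym⁻¹ = Ψl⁻¹ + Ψr⁻¹ − D⁻¹. -/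
noncomputable def Phisym {n m : ℕ} (S : Mat n m) : Mat n m :=
  (stairL S)⁻¹ + (stairR S)⁻¹ - (blockDiagPart S)⁻¹

/-- All diagonal blocks are invertible m×m matrices. -/
def DiagBlocksInvertible {n m : ℕ} (M : Mat n m) : Prop :=
  ∀ i : Fin n, IsUnit (blockOf M i i)

/-- v_e : the part of v supported on blocks of odd index (0-indexed). -/
def vE {n m : ℕ} (v : Vec n m) : Vec n m := fun p => if Odd p.1.val then v p else 0

/-- v_o : the part of v supported on blocks of even index (0-indexed). -/
def vO {n m : ℕ} (v : Vec n m) : Vec n m := fun p => if Even p.1.val then v p else 0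

/-- A stair matrix: block tridiagonal, with off-diagonal blocks nonzero only in
block rows of a fixed parity (a left stair has them only in odd-indexed rows,
a right stair only in even-indexed rows, 0-indexed). -/
def IsStairMatrix {n m : ℕ} (Ψ : Mat n m) : Prop :=
  IsBlockTridiag Ψ ∧
    ((∀ i j : Fin n, i ≠ j → Even i.val → blockOf Ψ i j = 0) ∨
     (∀ i j : Fin n, i ≠ j → Odd i.val → blockOf Ψ i j = 0))

/-- If the off-diagonal blocks of row `i` do not contribute to `M *ᵥ w`, the `i`-th block of the
product is computed by the diagonal block alone. -/
theorem mulVec_apply_eq_diag_block {n m : ℕ} (M : Mat n m) (w : Vec n m) (i : Fin n)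
    (h : ∀ a j b, i ≠ j → M (i, a) (j, b) * w (j, b) = 0) (a : Fin m) :
    (M *ᵥ w) (i, a) = (blockOf M i i *ᵥ fun b => w (i, b)) a := by
  simp only [mulVec, dotProduct, Fintype.sum_prod_type, blockOf]
  refine Finset.sum_eq_single i (fun j _ hj => ?_) (by simp)
  exact Finset.sum_eq_zero fun b _ => h a j b hj.symm

/-- A block matrix with invertible diagonal blocks, whose off-diagonal blocks only couple rows in a
set `P` to columns outside `P`, is invertible. -/
theorem isUnit_of_bipartite {n m : ℕ} (M : Mat n m) (hdiag : DiagBlocksInvertible M)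
    (P : Fin n → Prop)
    (hM : ∀ p q : Fin n × Fin m, p.1 ≠ q.1 → ¬(P p.1 ∧ ¬P q.1) → M p q = 0) : IsUnit M := by
  rw [← mulVec_injective_iff_isUnit]
  refine (injective_iff_map_eq_zero M.mulVecLin).2 fun w hw => ?_
  have block_zero : ∀ i, (∀ a j b, i ≠ j → M (i, a) (j, b) * w (j, b) = 0) →
      ∀ b, w (i, b) = 0 := by
    intro i hi b
    have h0 : blockOf M i i *ᵥ (fun b => w (i, b)) = blockOf M i i *ᵥ 0 := by
      rw [mulVec_zero]
      ext a
      rw [← mulVec_apply_eq_diag_block M w i hi a]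
      exact congrFun hw (i, a)
    exact congrFun (mulVec_injective_iff_isUnit.2 (hdiag i) h0) b
  have outside : ∀ i, ¬P i → ∀ b, w (i, b) = 0 := fun i hi =>
    block_zero i fun a j b hij => by
      rw [hM (i, a) (j, b) hij fun h => hi h.1, zero_mul]
  ext ⟨i, b⟩
  refine block_zero i (fun a j b hij => ?_) b
  by_cases hj : P j
  · rw [hM (i, a) (j, b) hij fun h => h.2 hj, zero_mul]
  · rw [outside j hj b, mul_zero]

theorem isUnit_stairL {n m : ℕ} {S : Mat n m} (hdiag : DiagBlocksInvertible S) :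
    IsUnit (stairL S) := by
  refine isUnit_of_bipartite _ (fun i => ?_) (fun i => Odd i.val) fun p q hpq h => ?_
  · convert hdiag i using 1
    ext a b
    simp [blockOf, stairL]
  · refine if_neg ?_
    grind

theorem isUnit_stairR {n m : ℕ} {S : Mat n m} (hdiag : DiagBlocksInvertible S) :
    IsUnit (stairR S) := by
  refine isUnit_of_bipartite _ (fun i => ?_) (fun i => Even i.val) fun p q hpq h => ?_
  · convert hdiag i using 1
    ext a b
    simp [blockOf, stairR]
  · refine if_neg ?_
    grind

theorem isUnit_blockDiagPart {n m : ℕ} {S : Mat n m} (hdiag : DiagBlocksInvertible S) :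
    IsUnit (blockDiagPart S) := by
  refine isUnit_of_bipartite _ (fun i => ?_) (fun _ => False) fun p q hpq _ => if_neg hpq
  convert hdiag i using 1
  ext a b
  simp [blockOf, blockDiagPart]

/-- On vectors supported on odd blocks, the left stair acts as the block-diagonal part. -/
theorem stairL_mulVec_eq_blockDiagPart_mulVec {n m : ℕ} (S : Mat n m) {v : Vec n m}
    (hsupp : ∀ p : Fin n × Fin m, Even p.1.val → v p = 0) :
    stairL S *ᵥ v = blockDiagPart S *ᵥ v := by
  ext p
  refine Finset.sum_congr rfl fun q _ => ?_
  have := hsupp q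
  simp only [stairL, blockDiagPart]
  grind

/-- On vectors supported on odd blocks, the right stair of a block tridiagonal matrix acts as the
matrix itself. -/
theorem stairR_mulVec_eq_mulVec {n m : ℕ} {S : Mat n m} (htri : IsBlockTridiag S) {v : Vec n m}
    (hsupp : ∀ p : Fin n × Fin m, Even p.1.val → v p = 0) :
    stairR S *ᵥ v = S *ᵥ v := by
  ext p
  refine Finset.sum_congr rfl fun q _ => ?_
  have hv := hsupp q
  have hS : p.1.val + 1 < q.1.val ∨ q.1.val + 1 < p.1.val → S p q = 0 := fun h =>
    congrFun (congrFun (htri p.1 q.1 h) p.2) q.2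
  have hpq : p.1 = q.1 ↔ p.1.val = q.1.val := Fin.ext_iff
  simp only [stairR]
  grind

theorem inv_mulVec_eq_of_mulVec_eq {ι : Type*} [Fintype ι] [DecidableEq ι] {A : Matrix ι ι ℝ}
    (hA : IsUnit A) {v w : ι → ℝ} (h : A *ᵥ v = w) : A⁻¹ *ᵥ w = v := by
  rw [← h, mulVec_mulVec, nonsing_inv_mul A ((isUnit_iff_isUnit_det A).1 hA), one_mulVec]

/-- If v ≠ 0 is supported on blocks of odd index and Ψl⁻¹ * Pl *ᵥ v = 0, then
(1, v) is an eigenpair of Φsym⁻¹ * S. -/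
theorem sym_eigenpair_one_of_left_kernel {n m : ℕ} (hn : 0 < n) (hm : 0 < m)
    (S : Mat n m) (hsymm : S.IsSymm) (htri : IsBlockTridiag S)
    (hdiag : DiagBlocksInvertible S)
    (v : Vec n m) (hv : v ≠ 0)
    (hsupp : ∀ p : Fin n × Fin m, Even p.1.val → v p = 0)
    (hker : ((stairL S)⁻¹ * Pl S) *ᵥ v = 0) :
    (Phisym S * S) *ᵥ v = v := by
  have hL : stairL S *ᵥ v = S *ᵥ v := by
    have hP : Pl S *ᵥ v = 0 := by
      refine mulVec_injective_iff_isUnit.2 (isUnit_nonsing_inv_iff.2 (isUnit_stairL hdiag)) ?_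
      rw [mulVec_mulVec, hker, mulVec_zero]
    rwa [Pl, sub_mulVec, sub_eq_zero] at hP
  have hD : blockDiagPart S *ᵥ v = S *ᵥ v :=
    (stairL_mulVec_eq_blockDiagPart_mulVec S hsupp).symm.trans hL
  have hR := stairR_mulVec_eq_mulVec htri hsupp
  rw [← mulVec_mulVec, Phisym, sub_mulVec, add_mulVec,
    inv_mulVec_eq_of_mulVec_eq (isUnit_stairL hdiag) hL,
    inv_mulVec_eq_of_mulVec_eq (isUnit_stairR hdiag) hR,
    inv_mulVec_eq_of_mulVec_eq (isUnit_blockDiagPart hdiag) hD, add_sub_cancel_right]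

end StairPrecond
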